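/- Let G be a measurement model that is graphically maximal and satisfies graphical condition (c), with 𝓘 the complete family of intervention targets. If the latent DAG of G (the induced directed graph on the hidden vertices H) has exactly one source vertex (a hidden vertex with no parents), then G has no imaginary subsets. -/

import Mathlib

universe u

/-- Acyclicity of a directed graph given by its edge relation. -/
def IsDAG {V : Type u} (E : V → V → Prop) : Prop :=
  ∀ v : V, ¬ Relation.TransGen E v v

/-- Hard intervention with target set `I`: delete every edge whose head lies in `I`. -/
def intervene {V : Type u} (E : V → V → Prop) (I : Set V) : V → V → Prop :=
  fun u v => E u v ∧ v ∉ I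

/-- Activity condition at an interior vertex `v` of a path, with neighbours `u` and `w`:
if `v` is a collider (both path edges point into `v`) then `v` or one of its directed
descendants must lie in `C`; otherwise `v` must not lie in `C`. -/
def ActiveTriple {V : Type u} (E : V → V → Prop) (C : Set V) (u v w : V) : Prop :=
  ((E u v ∧ E w v) → ∃ d, Relation.ReflTransGen E v d ∧ d ∈ C) ∧
  (¬ (E u v ∧ E w v) → v ∉ C)

/-- Every interior vertex of the vertex list satisfies the activity condition. -/
def TriplesActive {V : Type u} (E : V → V → Prop) (C : Set V) : List V → Prop
  | u :: v :: w :: rest => ActiveTriple E C u v w ∧ TriplesActive E C (v :: w :: rest)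
  | _ => True

/-- `p` is an active path between `a` and `b` given the conditioning set `C`. -/
def IsActivePath {V : Type u} (E : V → V → Prop) (C : Set V) (p : List V) (a b : V) : Prop :=
  p.Nodup ∧ p.head? = some a ∧ p.getLast? = some b ∧
  List.Chain' (fun u v => E u v ∨ E v u) p ∧ TriplesActive E C p

/-- Two single vertices are d-connected given `C`. -/
def dconn {V : Type u} (E : V → V → Prop) (C : Set V) (a b : V) : Prop :=
  ∃ p : List V, IsActivePath E C p a b

/-- Two single vertices are d-separated given `C`. -/
def dsepV {V : Type u} (E : V → V → Prop) (C : Set V) (a b : V) : Prop :=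
  ¬ dconn E C a b

/-- Vertex sets `A` and `B` are d-separated given `C`. -/
def dsep {V : Type u} (E : V → V → Prop) (A B C : Set V) : Prop :=
  ∀ a ∈ A, ∀ b ∈ B, dsepV E C a b

/-- `𝒯(G)`: the set of d-separation triples of pairwise disjoint vertex sets. -/
def Tsep {V : Type u} (E : V → V → Prop) : Set (Set V × Set V × Set V) :=
  { t | Disjoint t.1 t.2.1 ∧ Disjoint t.1 t.2.2 ∧ Disjoint t.2.1 t.2.2 ∧
        dsep E t.1 t.2.1 t.2.2 }

/-- An edge `u → v` is isolated: `u` has no parents and the only parent of `v` is `u`. -/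
def IsolatedEdge {V : Type u} (E : V → V → Prop) (u v : V) : Prop :=
  E u v ∧ (∀ w, ¬ E w u) ∧ (∀ w, E w v → w = u)

/-- The graph obtained by reversing the edge `u → v`. -/
def reverseEdge {V : Type u} (E : V → V → Prop) (u v : V) : V → V → Prop :=
  fun a b => (E a b ∧ ¬ (a = u ∧ b = v)) ∨ (a = v ∧ b = u)

/-- One step of isolated-edge reversal between DAGs. -/
def IsoStep {V : Type u} (E₁ E₂ : V → V → Prop) : Prop :=
  IsDAG E₁ ∧ IsDAG E₂ ∧ ∃ u v, IsolatedEdge E₁ u v ∧ E₂ = reverseEdge E₁ u v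

/-- Isolated equivalence: a finite sequence of isolated-edge reversals,
each intermediate graph being a DAG. -/
def IsoEquiv {V : Type u} (E₁ E₂ : V → V → Prop) : Prop :=
  Relation.ReflTransGen IsoStep E₁ E₂

/-- An edge `u → v` is covered: `pa(v) = pa(u) ∪ {u}`. -/
def CoveredEdge {V : Type u} (E : V → V → Prop) (u v : V) : Prop :=
  E u v ∧ ∀ w, E w v ↔ (E w u ∨ w = u)

/-- `p` is a directed path from `a` to `b`. -/
def IsDirPath {V : Type u} (E : V → V → Prop) (p : List V) (a b : V) : Prop :=
  p.Nodup ∧ p.head? = some a ∧ p.getLast? = some b ∧ List.Chain' E p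

/-- A measurement model on observed vertices `Xs` and hidden vertices `Hs`:
a DAG in which every edge goes from a hidden vertex to an observed or hidden one
(so observed vertices have no outgoing edges and all their parents are hidden). -/
def IsMeasurementModel {V : Type u} (E : V → V → Prop) (Xs Hs : Set V) : Prop :=
  IsDAG E ∧ Disjoint Xs Hs ∧ ∀ u v, E u v → u ∈ Hs ∧ (v ∈ Xs ∨ v ∈ Hs)

/-- Observed children of a hidden vertex. -/
def chSet {V : Type u} (E : V → V → Prop) (Xs : Set V) (h : V) : Set V :=
  {x | x ∈ Xs ∧ E h x}

/-- Undirected dependency graph on `Xs`: distinct observed vertices are adjacent iff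
they are d-connected given the empty set. -/
def UDG {V : Type u} (E : V → V → Prop) (Xs : Set V) : V → V → Prop :=
  fun x x' => x ∈ Xs ∧ x' ∈ Xs ∧ x ≠ x' ∧ dconn E ∅ x x'

/-- `C` is a clique of the undirected graph `R` on vertex set `Xs`. -/
def IsCliqueIn {V : Type u} (R : V → V → Prop) (Xs C : Set V) : Prop :=
  C ⊆ Xs ∧ ∀ x ∈ C, ∀ y ∈ C, x ≠ y → R x y

/-- `C` is an inclusion-maximal clique of `R` on `Xs`. -/
def IsMaxCliqueIn {V : Type u} (R : V → V → Prop) (Xs C : Set V) : Prop :=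
  IsCliqueIn R Xs C ∧ ∀ C', IsCliqueIn R Xs C' → C ⊆ C' → C = C'

/-- The complete family of intervention targets `𝓘 = {∅} ∪ {{h} : h ∈ H}`. -/
def completeFamily {V : Type u} (Hs : Set V) : Set (Set V) :=
  insert ∅ ((fun h => ({h} : Set V)) '' Hs)

/-- `Ω_G^(I)`: the set of maximal cliques of `UDG(G^(I))`. -/
def maxCliques {V : Type u} (E : V → V → Prop) (Xs I : Set V) : Set (Set V) :=
  {C | IsMaxCliqueIn (UDG (intervene E I) Xs) Xs C}

/-- `Ω = ⋃_{I ∈ 𝓘} Ω_G^(I)`. -/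
def Omega {V : Type u} (E : V → V → Prop) (Xs Hs : Set V) : Set (Set V) :=
  ⋃ I ∈ completeFamily Hs, maxCliques E Xs I

/-- A valid subset of the observed vertices. -/
def ValidSubset {V : Type u} (E : V → V → Prop) (Xs Hs X' : Set V) : Prop :=
  X' ⊆ Xs ∧ ∀ I ∈ completeFamily Hs, ∃ C ∈ maxCliques E Xs I, X' ⊆ C

/-- A maximal valid subset. -/
def MaxValidSubset {V : Type u} (E : V → V → Prop) (Xs Hs X' : Set V) : Prop :=
  ValidSubset E Xs Hs X' ∧
  ¬ ∃ X'', ValidSubset E Xs Hs X'' ∧ X' ⊂ X'' ∧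
      ∀ C ∈ Omega E Xs Hs, X' ⊆ C → X'' ⊆ C

/-- An imaginary subset: a maximal valid subset not contained in the child set of
any hidden vertex. -/
def ImaginarySubset {V : Type u} (E : V → V → Prop) (Xs Hs X' : Set V) : Prop :=
  MaxValidSubset E Xs Hs X' ∧ ¬ ∃ h ∈ Hs, X' ⊆ chSet E Xs h

/-- A replaceable subset: a maximal valid subset strictly contained in another
maximal valid subset. -/
def ReplaceableSubset {V : Type u} (E : V → V → Prop) (Xs Hs X' : Set V) : Prop :=
  MaxValidSubset E Xs Hs X' ∧ ∃ X'', MaxValidSubset E Xs Hs X'' ∧ X' ⊂ X''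

/-- Graphical condition (c). -/
def CondC {V : Type u} (E : V → V → Prop) (Xs Hs : Set V) : Prop :=
  ∀ I ∈ completeFamily Hs, ∀ h ∈ Hs, ∀ h' ∈ Hs, h ≠ h' →
    dsepV (intervene E I) ∅ h h' →
    ∃ x ∈ chSet E Xs h, ∃ x' ∈ chSet E Xs h', dsepV (intervene E I) ∅ x x'

/-- Add an edge `a → b` to a graph. -/
def addEdge {V : Type u} (E : V → V → Prop) (a b : V) : V → V → Prop :=
  fun u v => E u v ∨ (u = a ∧ v = b)

/-- Graphical maximality of a measurement model. -/
def GraphMaximal {V : Type u} (E : V → V → Prop) (Xs Hs : Set V) : Prop :=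
  (∀ x ∈ Xs, ∃ v, E v x) ∧
  ∀ h ∈ Hs, ∀ x ∈ Xs, ¬ E h x →
    ∃ I ∈ completeFamily Hs,
      UDG (intervene (addEdge E h x) I) Xs ≠ UDG (intervene E I) Xs

/-- A clique `C` is shattered by a collection `S` if some subcollection of `S`
has union exactly `C`. -/
def Shattered {V : Type u} (S : Set (Set V)) (C : Set V) : Prop :=
  ∃ S' ⊆ S, C = ⋃₀ S'

/-- A complete collection of maximal valid subsets: for every intervention target,
every edge of the UDG has both endpoints in some shattered maximal clique. -/
def CompleteCollection {V : Type u} (E : V → V → Prop) (Xs Hs : Set V)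
    (S : Set (Set V)) : Prop :=
  (∀ s ∈ S, MaxValidSubset E Xs Hs s) ∧
  ∀ I ∈ completeFamily Hs, ∀ x x' : V, UDG (intervene E I) Xs x x' →
    ∃ C ∈ maxCliques E Xs I, x ∈ C ∧ x' ∈ C ∧ Shattered S C

/-- A fractured subset. -/
def FracturedSubset {V : Type u} (E : V → V → Prop) (Xs Hs X' : Set V) : Prop :=
  MaxValidSubset E Xs Hs X' ∧
  ∃ S, CompleteCollection E Xs Hs S ∧ ∀ s ∈ S, ¬ s ⊆ X'

/-- The pure-child assumption. -/
def PureChild {V : Type u} (E : V → V → Prop) (Xs Hs : Set V) : Prop :=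
  ∀ h ∈ Hs, ∃ x ∈ Xs, E h x ∧ ∀ w, E w x → w = h

/-- The latent DAG: the induced directed graph on the hidden vertices. -/
def latentGraph {V : Type u} (E : V → V → Prop) (Hs : Set V) : V → V → Prop :=
  fun u v => u ∈ Hs ∧ v ∈ Hs ∧ E u v

/-- A common-parent path `x1 ← h → x2`. -/
def IsCPPath {V : Type u} (p : List V) (x1 x2 : V) : Prop :=
  ∃ h, p = [x1, h, x2]

/-- A sparse measurement model. -/
def SparseMM {V : Type u} (E : V → V → Prop) (Xs Hs : Set V) : Prop :=
  (∀ x1 ∈ Xs, ∀ x2 ∈ Xs, x1 ≠ x2 → dconn E ∅ x1 x2 →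
    (∀ h ∈ Hs, ∀ h' ∈ Hs,
        x1 ∈ chSet E Xs h → x2 ∈ chSet E Xs h →
        x1 ∈ chSet E Xs h' → x2 ∈ chSet E Xs h' → h = h') ∧
    (∀ p q : List V,
        IsActivePath E ∅ p x1 x2 → ¬ IsCPPath p x1 x2 →
        IsActivePath E ∅ q x1 x2 → ¬ IsCPPath q x1 x2 → p = q)) ∧
  (∀ x1 ∈ Xs, ∀ x2 ∈ Xs, ∀ x3 ∈ Xs, ∀ h2 ∈ Hs, ∀ h3 ∈ Hs, h2 ≠ h3 →
    x1 ∈ chSet E Xs h2 → x2 ∈ chSet E Xs h2 →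
    x1 ∈ chSet E Xs h3 → x3 ∈ chSet E Xs h3 →
    ∀ p : List V, IsActivePath E ∅ p x2 x3 →
      ¬ IsCPPath p x2 x3 ∧ p[1]? = some h2 ∧ p.reverse[1]? = some h3)

open Relation

section Paths

variable {V : Type u} {E : V → V → Prop}

/-- Along a path without colliders that starts with a forward edge, every edge is forward. -/
lemma reflTransGen_getLast_of_forward (u v : V) (t : List V) (b : V) (huv : E u v)
    (hlast : (u :: v :: t).getLast? = some b)
    (hch : List.IsChain (fun u v => E u v ∨ E v u) (u :: v :: t))
    (htr : TriplesActive E ∅ (u :: v :: t)) : ReflTransGen E v b := by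
  induction t generalizing u v with
  | nil =>
    obtain rfl : v = b := by simpa using hlast
    exact .refl
  | cons w t ih =>
    have hwv : ¬ E w v := fun h => by
      obtain ⟨d, -, hd⟩ := htr.1.1 ⟨huv, h⟩
      exact hd
    have hch' := (List.isChain_cons_cons.mp hch).2
    have hvw : E v w := (List.isChain_cons_cons.mp hch').1.resolve_right hwv
    exact .head hvw (ih v w hvw (by simpa using hlast) hch' htr.2)

lemma exists_common_ancestor_of_active (a b : V) (t : List V)
    (hlast : (a :: t).getLast? = some b)
    (hch : List.IsChain (fun u v => E u v ∨ E v u) (a :: t))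
    (htr : TriplesActive E ∅ (a :: t)) : ∃ c, ReflTransGen E c a ∧ ReflTransGen E c b := by
  induction t generalizing a with
  | nil =>
    obtain rfl : a = b := by simpa using hlast
    exact ⟨a, .refl, .refl⟩
  | cons v t ih =>
    obtain ⟨hav | hva, hch'⟩ := List.isChain_cons_cons.mp hch
    · exact ⟨a, .refl, .head hav (reflTransGen_getLast_of_forward a v t b hav hlast hch htr)⟩
    · have htr' : TriplesActive E ∅ (v :: t) := by
        cases t with
        | nil => trivial
        | cons w t => exact htr.2
      obtain ⟨c, hcv, hcb⟩ := ih v (by simpa using hlast) hch' htr'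
      exact ⟨c, hcv.tail hva, hcb⟩

lemma exists_common_ancestor_of_dconn {a b : V} (h : dconn E ∅ a b) :
    ∃ c, ReflTransGen E c a ∧ ReflTransGen E c b := by
  obtain ⟨p, -, hhead, hlast, hch, htr⟩ := h
  cases p with
  | nil => simp at hhead
  | cons a' t =>
    obtain rfl : a' = a := by simpa using hhead
    exact exists_common_ancestor_of_active _ b t hlast hch htr

lemma IsDAG.asymm (hE : IsDAG E) {u v : V} (h : E u v) : ¬ E v u :=
  fun h' => hE u (.head h (.single h'))

/-- A triple with an edge out of its middle vertex is active given the empty set. -/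
lemma activeTriple_empty {u v w : V} (h : ¬ (E u v ∧ E w v)) : ActiveTriple E ∅ u v w :=
  ⟨fun h' => (h h').elim, fun _ => id⟩

lemma exists_directed_path (hE : IsDAG E) {c b : V} (h : ReflTransGen E c b) :
    ∃ t : List V, (c :: t).Nodup ∧ (c :: t).getLast? = some b ∧ List.IsChain E (c :: t) ∧
      TriplesActive E ∅ (c :: t) ∧ (∀ v ∈ t, TransGen E c v ∧ ReflTransGen E v b) := by
  induction h using ReflTransGen.head_induction_on with
  | refl => exact ⟨[], by simp, by simp, by simp, trivial, by simp⟩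
  | @head a a' haa' ha'b ih =>
    obtain ⟨t, hnd, hlast, hch, htr, hmem⟩ := ih
    have hmem' : ∀ v ∈ a' :: t, TransGen E a v ∧ ReflTransGen E v b := by
      intro v hv
      rcases List.mem_cons.mp hv with rfl | hv
      · exact ⟨.single haa', ha'b⟩
      · exact ⟨.head haa' (hmem v hv).1, (hmem v hv).2⟩
    refine ⟨a' :: t, List.nodup_cons.mpr ⟨fun ha => hE a (hmem' a ha).1, hnd⟩,
      by simpa using hlast, List.isChain_cons_cons.mpr ⟨haa', hch⟩, ?_, hmem'⟩
    cases t with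
    | nil => trivial
    | cons w t =>
      exact ⟨activeTriple_empty fun h => hE.asymm (List.isChain_cons_cons.mp hch).1 h.2, htr⟩

lemma exists_active_path (hE : IsDAG E) {a b c : V}
    (hmin : ∀ v, TransGen E c v → ReflTransGen E v a → ¬ ReflTransGen E v b)
    (hcb : ReflTransGen E c b) (d : V) (hcd : ReflTransGen E c d) (hda : ReflTransGen E d a) :
    ∃ t : List V, (d :: t).Nodup ∧ (d :: t).getLast? = some b ∧
      List.IsChain (fun u v => E u v ∨ E v u) (d :: t) ∧ TriplesActive E ∅ (d :: t) ∧
      (∀ v ∈ d :: t, ReflTransGen E v d ∨ (TransGen E c v ∧ ReflTransGen E v b)) := by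
  induction hcd with
  | refl =>
    obtain ⟨t, hnd, hlast, hch, htr, hmem⟩ := exists_directed_path hE hcb
    refine ⟨t, hnd, hlast, hch.imp fun _ _ => Or.inl, htr, fun v hv => ?_⟩
    rcases List.mem_cons.mp hv with rfl | hv
    · exact .inl .refl
    · exact .inr (hmem v hv)
  | @tail d' d hcd' hd'd ih =>
    obtain ⟨t, hnd, hlast, hch, htr, hmem⟩ := ih (.head hd'd hda)
    have hnot : d ∉ d' :: t := fun hd => by
      rcases hmem d hd with h | ⟨h, h'⟩
      · exact hE d (TransGen.tail' h hd'd)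
      · exact hmin d h hda h'
    refine ⟨d' :: t, List.nodup_cons.mpr ⟨hnot, hnd⟩, by simpa using hlast,
      List.isChain_cons_cons.mpr ⟨.inr hd'd, hch⟩, ?_, fun v hv => ?_⟩
    · cases t with
      | nil => trivial
      | cons w t => exact ⟨activeTriple_empty fun h => hE.asymm hd'd h.1, htr⟩
    · rcases List.mem_cons.mp hv with rfl | hv
      · exact .inl .refl
      · exact (hmem v hv).imp_left fun h => h.tail hd'd

lemma IsDAG.wellFounded [Finite V] (hE : IsDAG E) : WellFounded (TransGen E) :=
  have : Std.Irrefl (TransGen E) := ⟨hE⟩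
  Finite.wellFounded_of_trans_of_irrefl _

lemma IsDAG.wellFounded_swap [Finite V] (hE : IsDAG E) :
    WellFounded (Function.swap (TransGen E)) :=
  have : Std.Irrefl (Function.swap (TransGen E)) := ⟨hE⟩
  have : IsTrans V (Function.swap (TransGen E)) := ⟨fun _ _ _ h h' => TransGen.trans h' h⟩
  Finite.wellFounded_of_trans_of_irrefl _

/-- In a finite DAG, two vertices are d-connected given the empty set if and only if they have
a common ancestor. -/
lemma dconn_empty_iff [Finite V] (hE : IsDAG E) {a b : V} :
    dconn E ∅ a b ↔ ∃ c, ReflTransGen E c a ∧ ReflTransGen E c b := by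
  refine ⟨exists_common_ancestor_of_dconn, fun h => ?_⟩
  obtain ⟨c, ⟨hca, hcb⟩, hmin⟩ := hE.wellFounded_swap.has_min
    {c | ReflTransGen E c a ∧ ReflTransGen E c b} h
  obtain ⟨t, hnd, hlast, hch, htr, -⟩ := exists_active_path hE
    (fun v hcv hva hvb => hmin v ⟨hva, hvb⟩ hcv) hcb a hca .refl
  exact ⟨a :: t, hnd, rfl, hlast, hch, htr⟩

lemma IsDAG.mono {F : V → V → Prop} (hE : IsDAG E) (h : ∀ u v, F u v → E u v) : IsDAG F :=
  fun v hv => hE v (TransGen.mono h v v hv)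

lemma IsDAG.intervene (hE : IsDAG E) (I : Set V) : IsDAG (intervene E I) :=
  hE.mono fun _ _ h => h.1

lemma reflTransGen_of_intervene {I : Set V} {a b : V} (h : ReflTransGen (intervene E I) a b) :
    ReflTransGen E a b :=
  ReflTransGen.mono (fun _ _ h => h.1) _ _ h

/-- A directed path either survives the intervention on `k`, or it passes through `k` and its
part after `k` survives. -/
lemma reflTransGen_intervene_or {k a b : V} (h : ReflTransGen E a b) :
    ReflTransGen (intervene E {k}) a b ∨
      (ReflTransGen E a k ∧ ReflTransGen (intervene E {k}) k b) := by
  induction h with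
  | refl => exact .inl .refl
  | @tail v b hav hvb ih =>
    by_cases hbk : b = k
    · subst hbk
      exact .inr ⟨hav.tail hvb, .refl⟩
    · exact ih.imp (fun h => h.tail ⟨hvb, hbk⟩) fun h => ⟨h.1, h.2.tail ⟨hvb, hbk⟩⟩

lemma reflTransGen_intervene_self {k b : V} (h : ReflTransGen E k b) :
    ReflTransGen (intervene E {k}) k b :=
  (reflTransGen_intervene_or h).elim id And.right

lemma intervene_singleton_of_source {s : V} (hs : ∀ w, ¬ E w s) :
    intervene E {s} = intervene E ∅ := by
  funext u v
  refine propext ⟨fun h => ⟨h.1, id⟩, fun h => ⟨h.1, ?_⟩⟩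
  rintro rfl
  exact hs u h.1

end Paths

section MeasurementModel

variable {V : Type u} {E : V → V → Prop} {Xs Hs : Set V}

lemma isDAG_addEdge (hmm : IsMeasurementModel E Xs Hs) {h x : V} (hh : h ∈ Hs) (hx : x ∈ Xs) :
    IsDAG (addEdge E h x) := by
  obtain ⟨hE, hdisj, hedge⟩ := hmm
  have hxH : x ∉ Hs := Set.disjoint_left.mp hdisj hx
  have tail_mem : ∀ {u v}, addEdge E h x u v → u ∈ Hs := by
    rintro u v (huv | ⟨rfl, rfl⟩)
    exacts [(hedge u v huv).1, hh]
  have edge : ∀ {u v}, addEdge E h x u v → v ∈ Hs → E u v := by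
    rintro u v (huv | ⟨rfl, rfl⟩) hv
    exacts [huv, (hxH hv).elim]
  have key : ∀ u v, TransGen (addEdge E h x) u v → v ∈ Hs → TransGen E u v := by
    intro u v huv
    induction huv with
    | single huv => exact fun hv => .single (edge huv hv)
    | tail _ hwv ih => exact fun hv => .tail (ih (tail_mem hwv)) (edge hwv hv)
  intro v hv
  obtain ⟨w, hvw, -⟩ := TransGen.head'_iff.mp hv
  exact hE v (key v v hv (tail_mem hvw))

/-- An ancestor of a vertex of the model is a vertex of the model. -/
lemma mem_of_reflTransGen (hmm : IsMeasurementModel E Xs Hs) {c v : V}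
    (h : ReflTransGen E c v) (hv : v ∈ Xs ∪ Hs) : c ∈ Xs ∪ Hs := by
  rcases ReflTransGen.cases_head h with rfl | ⟨w, hcw, -⟩
  exacts [hv, .inr (hmm.2.2 c w hcw).1]

/-- With a unique latent source `s`, after intervening on `k` every vertex of the model descends
from `s` or from `k`. -/
lemma reflTransGen_source_or_target [Finite V] (hmm : IsMeasurementModel E Xs Hs)
    (hpar : ∀ x ∈ Xs, ∃ v, E v x) {s : V}
    (hs : ∀ v ∈ Hs, (∀ w, ¬ latentGraph E Hs w v) → v = s) (k v : V) (hv : v ∈ Xs ∪ Hs) :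
    ReflTransGen (intervene E {k}) s v ∨ ReflTransGen (intervene E {k}) k v := by
  induction v using hmm.1.wellFounded.induction with
  | _ v ih =>
  by_cases hvs : v = s
  · exact .inl (hvs ▸ .refl)
  by_cases hvk : v = k
  · exact .inr (hvk ▸ .refl)
  obtain ⟨w, hwv⟩ : ∃ w, E w v := by
    rcases hv with hv | hv
    · exact hpar v hv
    · by_contra! hno
      exact hvs (hs v hv fun w hw => hno w hw.2.2)
  exact (ih w (.single hwv) (.inr (hmm.2.2 w v hwv).1)).imp
    (fun h => h.tail ⟨hwv, hvk⟩) (fun h => h.tail ⟨hwv, hvk⟩)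

/-- If every vertex of the model descends from `s` or from `k`, then every clique of the
dependency graph consists of descendants of `s` or of descendants of `k`. -/
lemma clique_subset_descendants (hmm : IsMeasurementModel E Xs Hs)
    {k s : V} {C : Set V}
    (hdesc : ∀ v ∈ Xs ∪ Hs,
      ReflTransGen (intervene E {k}) s v ∨ ReflTransGen (intervene E {k}) k v)
    (hC : IsCliqueIn (UDG (intervene E {k}) Xs) Xs C) :
    (∀ x ∈ C, ReflTransGen (intervene E {k}) s x) ∨
      (∀ x ∈ C, ReflTransGen (intervene E {k}) k x) := by
  by_contra! hcon
  obtain ⟨⟨a, haC, ha⟩, b, hbC, hb⟩ := hcon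
  obtain ⟨c, hca, hcb⟩ : ∃ c, ReflTransGen (intervene E {k}) c a ∧
      ReflTransGen (intervene E {k}) c b := by
    by_cases hab : a = b
    · exact ⟨a, .refl, hab ▸ .refl⟩
    · exact exists_common_ancestor_of_dconn (hC.2 a haC b hbC hab).2.2.2
  rcases hdesc c (mem_of_reflTransGen hmm (reflTransGen_of_intervene hca) (.inl (hC.1 haC)))
    with h | h
  exacts [ha (h.trans hca), hb (h.trans hcb)]

/-- Adding an edge `h → x` does not change the dependency graph under an intervention on `k` when
`x` already descends from each of `s`, `k` from which `h` descends. -/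
lemma UDG_intervene_addEdge_eq [Finite V] (hmm : IsMeasurementModel E Xs Hs) {k s h x : V}
    (hdesc : ∀ v ∈ Xs ∪ Hs,
      ReflTransGen (intervene E {k}) s v ∨ ReflTransGen (intervene E {k}) k v)
    (hh : h ∈ Hs) (hx : x ∈ Xs)
    (hsx : ReflTransGen (intervene E {k}) s h → ReflTransGen (intervene E {k}) s x)
    (hkx : ReflTransGen (intervene E {k}) k h → ReflTransGen (intervene E {k}) k x) :
    UDG (intervene (addEdge E h x) {k}) Xs = UDG (intervene E {k}) Xs := by
  have hmono : ∀ {u v}, ReflTransGen (intervene E {k}) u v →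
      ReflTransGen (intervene (addEdge E h x) {k}) u v :=
    ReflTransGen.mono (fun _ _ h => ⟨.inl h.1, h.2⟩) _ _
  have hback : ∀ t, (ReflTransGen (intervene E {k}) t h → ReflTransGen (intervene E {k}) t x) →
      ∀ v, ReflTransGen (intervene (addEdge E h x) {k}) t v →
        ReflTransGen (intervene E {k}) t v := by
    intro t ht v htv
    induction htv with
    | refl => exact .refl
    | tail _ hwv ih =>
      obtain ⟨hwv | ⟨rfl, rfl⟩, hvk⟩ := hwv
      exacts [ih.tail ⟨hwv, hvk⟩, ht ih]
  have hE' := isDAG_addEdge hmm hh hx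
  have hmem : ∀ {c y}, ReflTransGen (intervene (addEdge E h x) {k}) c y → y ∈ Xs →
      c ∈ Xs ∪ Hs := by
    intro c y hcy hy
    rcases ReflTransGen.cases_head hcy with rfl | ⟨w, ⟨hcw | ⟨rfl, -⟩, -⟩, -⟩
    exacts [.inl hy, .inr (hmm.2.2 c w hcw).1, .inr hh]
  funext y z
  refine propext (and_congr_right fun hy => and_congr_right fun _ => and_congr_right fun _ => ?_)
  rw [dconn_empty_iff (hE'.intervene _), dconn_empty_iff (hmm.1.intervene _)]
  refine ⟨fun ⟨c, hcy, hcz⟩ => ?_, fun ⟨c, hcy, hcz⟩ => ⟨c, hmono hcy, hmono hcz⟩⟩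
  rcases hdesc c (hmem hcy hy) with hc | hc
  · exact ⟨s, hback s hsx y ((hmono hc).trans hcy), hback s hsx z ((hmono hc).trans hcz)⟩
  · exact ⟨k, hback k hkx y ((hmono hc).trans hcy), hback k hkx z ((hmono hc).trans hcz)⟩

end MeasurementModel

/-- A graphically maximal measurement model satisfying condition (c)
whose latent DAG has exactly one source vertex has no imaginary subsets. -/
theorem statement17 {V : Type u} [Fintype V] (E : V → V → Prop) (Xs Hs : Set V)
    (hmm : IsMeasurementModel E Xs Hs)
    (hmax : GraphMaximal E Xs Hs) (hc : CondC E Xs Hs)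
    (hsrc : ∃! h : V, h ∈ Hs ∧ ∀ w : V, ¬ latentGraph E Hs w h) :
    ∀ X' : Set V, ¬ ImaginarySubset E Xs Hs X' := by
  rintro X' ⟨⟨⟨hX', hvalid⟩, -⟩, himag⟩
  obtain ⟨s, ⟨hsH, hs⟩, hsuniq⟩ := hsrc
  have hsE : ∀ w, ¬ E w s := fun w hw => hs w ⟨(hmm.2.2 w s hw).1, hsH, hw⟩
  have hdesc := reflTransGen_source_or_target hmm hmax.1 fun v hv hv' => hsuniq v ⟨hv, hv'⟩
  obtain ⟨h, ⟨hhH, hhX⟩, hmin⟩ := hmm.1.wellFounded_swap.has_min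
    {k | k ∈ Hs ∧ ∀ x ∈ X', ReflTransGen E k x}
    ⟨s, hsH, fun x hx => reflTransGen_of_intervene (or_self_iff.mp (hdesc s x (.inl (hX' hx))))⟩
  refine himag ⟨h, hhH, fun x hx => ⟨hX' hx, ?_⟩⟩
  by_contra hne
  have heq : ∀ k ∈ Hs, UDG (intervene (addEdge E h x) {k}) Xs = UDG (intervene E {k}) Xs := by
    intro k hk
    refine UDG_intervene_addEdge_eq hmm (hdesc k) hhH (hX' hx) (fun hsh => ?_) fun hkh =>
      reflTransGen_intervene_self ((reflTransGen_of_intervene hkh).trans (hhX x hx))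
    obtain ⟨C, hC, hXC⟩ := hvalid {k} (.inr ⟨k, hk, rfl⟩)
    rcases clique_subset_descendants hmm (hdesc k) hC.1 with hCs | hCk
    · exact hCs x (hXC hx)
    rcases reflTransGen_intervene_or (k := k) (hhX x hx) with hhx | ⟨hhk, hkx⟩
    · exact hsh.trans hhx
    rcases reflTransGen_iff_eq_or_transGen.mp hhk with rfl | hhk
    · exact hsh.trans hkx
    · exact (hmin k ⟨hk, fun y hy => reflTransGen_of_intervene (hCk y (hXC hy))⟩ hhk).elim
  obtain ⟨I, hI, hUDG⟩ := hmax.2 h hhH x (hX' hx) hne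
  rcases hI with rfl | ⟨k, hk, rfl⟩
  · refine hUDG ?_
    have hsE' : ∀ w, ¬ addEdge E h x w s := by
      rintro w (hw | ⟨-, rfl⟩)
      exacts [hsE w hw, Set.disjoint_left.mp hmm.2.1 (hX' hx) hsH]
    rw [← intervene_singleton_of_source hsE, ← intervene_singleton_of_source hsE']
    exact heq s hsH
  · exact hUDG (heq k hk)
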